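/- arXiv:2209.02742 — 2 statements merged into one kernel-verified Lean document; each statement's English description precedes it below -/
import Mathlib

section
/- Let ρ be a bounded ρ-function and let ε be a real random variable with density f₀ that is even, non-increasing in |t|, and strictly decreasing for |t| in a neighbourhood of 0. Then for every real number a ≠ 0 one has E[ρ(ε − a)] > E[ρ(ε)]. -/
open MeasureTheory Filter
open scoped RealInnerProductSpace ENNReal

noncomputable section

/-- A *bounded ρ-function*: bounded, continuous, even, non-decreasing on `[0,∞)`,
vanishing at `0`, with supremum `1`, and strictly increasing where it is below `1`. -/
def IsBoundedRho (ρ : ℝ → ℝ) : Prop :=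
  (∀ t, 0 ≤ ρ t) ∧ (∀ t, ρ t ≤ 1) ∧ Continuous ρ ∧ (∀ t, ρ (-t) = ρ t) ∧
    MonotoneOn ρ (Set.Ici (0 : ℝ)) ∧ ρ 0 = 0 ∧ (⨆ t, ρ t) = 1 ∧
    ∀ u v : ℝ, 0 ≤ u → u < v → ρ v < 1 → ρ u < ρ v

/-- The error has an even density `f₀`, non-increasing in `|t|` and strictly decreasing
for `|t|` in a neighbourhood of `0`. -/
def HasSymmUnimodalDensity {Ω : Type*} [MeasureSpace Ω] (ε : Ω → ℝ) : Prop :=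
  ∃ f₀ : ℝ → ℝ, (∀ t, 0 ≤ f₀ t) ∧
    Measure.map ε (volume : Measure Ω)
      = (volume : Measure ℝ).withDensity (fun t => ENNReal.ofReal (f₀ t)) ∧
    (∀ t, f₀ (-t) = f₀ t) ∧ (∀ s t : ℝ, |s| ≤ |t| → f₀ t ≤ f₀ s) ∧
    ∃ δ : ℝ, 0 < δ ∧ ∀ s t : ℝ, 0 ≤ s → s < t → t ≤ δ → f₀ t < f₀ s

variable {H : Type*} [NormedAddCommGroup H] [InnerProductSpace ℝ H]

/-- The rank-one operator `f ⊗ g : u ↦ ⟪f, u⟫ • g`. -/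
def rankOne (f g : H) : H →L[ℝ] H := (innerSL ℝ f).smulRight g

/-- Membership in `H_p`, the linear span of `φ 0, …, φ (p-1)`. -/
def inSpan (φ : ℕ → H) (p : ℕ) (β : H) : Prop :=
  ∃ bcoef : Fin p → ℝ, β = ∑ j : Fin p, bcoef j • φ (j : ℕ)

/-- Membership in `F_p`, the symmetric operators spanned by `φ j ⊗ φ ℓ`, `j, ℓ < p`. -/
def inFSpan (φ : ℕ → H) (p : ℕ) (Υ : H →L[ℝ] H) : Prop :=
  ∃ v : Fin p → Fin p → ℝ, (∀ j ℓ, v j ℓ = v ℓ j) ∧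
    Υ = ∑ j : Fin p, ∑ ℓ : Fin p, v j ℓ • rankOne (φ (j : ℕ)) (φ (ℓ : ℕ))

/-- `T` is a Hilbert–Schmidt operator. -/
def IsHilbertSchmidt (T : H →L[ℝ] H) : Prop :=
  ∃ b : HilbertBasis ℕ ℝ H, Summable fun i => ‖T (b i)‖ ^ 2

/-- The Hilbert–Schmidt norm of `T`, computed in the Hilbert basis `b`. -/
def hsNorm (b : HilbertBasis ℕ ℝ H) (T : H →L[ℝ] H) : ℝ :=
  Real.sqrt (∑' i, ‖T (b i)‖ ^ 2)

/-- The risk `L(a, β, Υ, ν, σ) = E ρ₁((y − a − ⟨X−ν, β⟩ − ⟨X−ν, Υ(X−ν)⟩)/σ)`. -/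
def risk {Ω : Type*} [MeasureSpace Ω]
    (ρ₁ : ℝ → ℝ) (y : Ω → ℝ) (X : Ω → H) (a : ℝ) (β : H) (Υ : H →L[ℝ] H)
    (ν : H) (σ : ℝ) : ℝ :=
  ∫ ω, ρ₁ ((y ω - a - ⟪X ω - ν, β⟫ - ⟪X ω - ν, Υ (X ω - ν)⟫) / σ)

namespace IsBoundedRho

variable {ρ : ℝ → ℝ}

lemma apply_abs (hρ : IsBoundedRho ρ) (t : ℝ) : ρ |t| = ρ t := by
  rcases abs_choice t with h | h <;> rw [h]
  exact hρ.2.2.2.1 t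

lemma le_of_abs_le_abs (hρ : IsBoundedRho ρ) {s t : ℝ} (h : |s| ≤ |t|) : ρ s ≤ ρ t := by
  rw [← hρ.apply_abs s, ← hρ.apply_abs t]
  exact hρ.2.2.2.2.1 (abs_nonneg s) (abs_nonneg t) h

lemma lt_of_abs_lt_abs (hρ : IsBoundedRho ρ) {s t : ℝ} (h : |s| < |t|) (hs : ρ s < 1) :
    ρ s < ρ t := by
  rcases lt_or_ge (ρ t) 1 with ht | ht
  · rw [← hρ.apply_abs s, ← hρ.apply_abs t]
    exact hρ.2.2.2.2.2.2.2 _ _ (abs_nonneg s) h (by rwa [hρ.apply_abs])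
  · exact hs.trans_le ht

lemma integrable_mul (hρ : IsBoundedRho ρ) {f : ℝ → ℝ} (hf : Integrable f) (a : ℝ) :
    Integrable fun t => ρ (t - a) * f t := by
  refine hf.bdd_mul (c := 1) ?_ (ae_of_all _ fun t => ?_)
  · exact (hρ.2.2.1.comp (continuous_sub_right a)).aestronglyMeasurable
  · rw [Real.norm_of_nonneg (hρ.1 _)]
    exact hρ.2.1 _

end IsBoundedRho

/-- A function that is non-increasing in `|t|` is measurable. -/
lemma measurable_of_antitone_abs {f : ℝ → ℝ} (hf : ∀ s t : ℝ, |s| ≤ |t| → f t ≤ f s) :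
    Measurable f := by
  have hanti : Antitone fun x : ℝ => f (max x 0) := fun x y hxy => hf _ _ <| by
    rw [abs_of_nonneg (le_max_right _ _), abs_of_nonneg (le_max_right _ _)]
    exact max_le_max_right 0 hxy
  have heq : f = (fun x : ℝ => f (max x 0)) ∘ fun t => |t| := funext fun t => by
    simp only [Function.comp_apply, max_eq_left (abs_nonneg t)]
    exact le_antisymm (hf _ _ (abs_abs t).le) (hf _ _ (abs_abs t).ge)
  rw [heq]
  exact hanti.measurable.comp measurable_norm

/-- Symmetrization of the gain in risk caused by a shift: twice the gain is the integral of
`(ρ (t - a) - ρ t) * (f t - f (t - a))`. -/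
lemma integral_symmetrized_shift {ρ f : ℝ → ℝ} (hρ : IsBoundedRho ρ) (hf : Integrable f)
    (heven : ∀ t, f (-t) = f t) (a : ℝ) :
    Integrable (fun t => (ρ (t - a) - ρ t) * (f t - f (t - a))) ∧
      ∫ t, (ρ (t - a) - ρ t) * (f t - f (t - a)) =
        2 * ((∫ t, ρ (t - a) * f t) - ∫ t, ρ t * f t) := by
  have i₁ : Integrable fun t => ρ (t - a) * f t := hρ.integrable_mul hf a
  have i₂ : Integrable fun t => ρ t * f t := by simpa using hρ.integrable_mul hf 0
  have i₃ : Integrable fun t => ρ t * f (t - a) := by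
    simpa using hρ.integrable_mul (hf.comp_sub_right a) 0
  have i₄ : Integrable fun t => ρ (t - a) * f (t - a) := hρ.integrable_mul (hf.comp_sub_right a) a
  have e₃ : ∫ t, ρ t * f (t - a) = ∫ t, ρ (t - a) * f t := by
    rw [← integral_sub_left_eq_self (fun t => ρ (t - a) * f t) volume a]
    congr 1 with t
    rw [show a - t - a = -t by ring, hρ.2.2.2.1, ← heven (t - a), neg_sub]
  have e₄ : ∫ t, ρ (t - a) * f (t - a) = ∫ t, ρ t * f t :=
    integral_sub_right_eq_self (fun t => ρ t * f t) a
  have hexp : (fun t => (ρ (t - a) - ρ t) * (f t - f (t - a))) =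
      fun t => (ρ (t - a) * f t - ρ t * f t) + (ρ t * f (t - a) - ρ (t - a) * f (t - a)) := by
    ext t; ring
  have i₁₂ : Integrable fun t => ρ (t - a) * f t - ρ t * f t := i₁.sub i₂
  have i₃₄ : Integrable fun t => ρ t * f (t - a) - ρ (t - a) * f (t - a) := i₃.sub i₄
  rw [hexp]
  refine ⟨i₁₂.add i₃₄, ?_⟩
  rw [integral_add i₁₂ i₃₄, integral_sub i₁ i₂, integral_sub i₃ i₄, e₃, e₄]
  ring

/-- Shifting strictly increases the integral of a bounded `ρ`-function against an even density
which is non-increasing in `|t|` and strictly so near `0`. -/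
lemma integral_mul_lt_integral_shift_mul {ρ f : ℝ → ℝ} (hρ : IsBoundedRho ρ) (hf : Integrable f)
    (heven : ∀ t, f (-t) = f t) (hanti : ∀ s t : ℝ, |s| ≤ |t| → f t ≤ f s) {δ : ℝ} (hδ : 0 < δ)
    (hstrict : ∀ s t : ℝ, 0 ≤ s → s < t → t ≤ δ → f t < f s) {a : ℝ} (ha : a ≠ 0) :
    ∫ t, ρ t * f t < ∫ t, ρ (t - a) * f t := by
  obtain ⟨hint, heq⟩ := integral_symmetrized_shift hρ hf heven a
  suffices h : 0 < ∫ t, (ρ (t - a) - ρ t) * (f t - f (t - a)) by linarith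
  have hnonneg : 0 ≤ fun t => (ρ (t - a) - ρ t) * (f t - f (t - a)) := fun t => by
    rcases le_total |t| |t - a| with h | h
    · exact mul_nonneg (sub_nonneg.2 (hρ.le_of_abs_le_abs h)) (sub_nonneg.2 (hanti _ _ h))
    · exact mul_nonneg_of_nonpos_of_nonpos (sub_nonpos.2 (hρ.le_of_abs_le_abs h))
        (sub_nonpos.2 (hanti _ _ h))
  rw [integral_pos_iff_support_of_nonneg hnonneg hint]
  have hopen : IsOpen {t : ℝ | |t| < δ ∧ ρ t < 1 ∧ |t| < |t - a|} :=
    (isOpen_lt continuous_abs continuous_const).inter <|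
      (isOpen_lt hρ.2.2.1 continuous_const).inter <|
        isOpen_lt continuous_abs (continuous_abs.comp (continuous_sub_right a))
  have hne : {t : ℝ | |t| < δ ∧ ρ t < 1 ∧ |t| < |t - a|}.Nonempty :=
    ⟨0, by simpa using hδ, by simp [hρ.2.2.2.2.2.1], by simpa using ha⟩
  refine (hopen.measure_pos volume hne).trans_le (measure_mono ?_)
  rintro t ⟨htδ, htρ, hta⟩
  have hlt : f (t - a) < f t := calc
    f (t - a) ≤ f (min |t - a| δ) := hanti _ _ <| by
      rw [abs_of_nonneg (le_min (abs_nonneg _) hδ.le)]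
      exact min_le_left _ _
    _ < f |t| := hstrict _ _ (abs_nonneg t) (lt_min hta htδ) (min_le_right _ _)
    _ ≤ f t := hanti _ _ (abs_abs t).ge
  exact ne_of_gt (mul_pos (sub_pos.2 (hρ.lt_of_abs_lt_abs hta htρ)) (sub_pos.2 hlt))

/-- Lemma 3.1 of Yohai and Zamar, as used in the paper:
if `ρ` is a bounded ρ-function and `ε` has an even density, non-increasing in `|t|`
and strictly decreasing for `|t|` near `0`, then `E ρ(ε − a) > E ρ(ε)` for every `a ≠ 0`. -/
theorem statement3
    {Ω : Type*} [MeasureSpace Ω] [IsProbabilityMeasure (volume : Measure Ω)]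
    (ρ : ℝ → ℝ) (hρ : IsBoundedRho ρ)
    (ε : Ω → ℝ) (hε : Measurable ε)
    (hdens : HasSymmUnimodalDensity ε)
    (a : ℝ) (ha : a ≠ 0) :
    (∫ ω, ρ (ε ω)) < ∫ ω, ρ (ε ω - a) := by
  obtain ⟨f, hf0, hmap, heven, hanti, δ, hδ, hstrict⟩ := hdens
  have hfm : Measurable f := measurable_of_antitone_abs hanti
  have hf : Integrable f := by
    refine ⟨hfm.aestronglyMeasurable, ?_⟩
    rw [hasFiniteIntegral_iff_ofReal (ae_of_all _ hf0), ← setLIntegral_univ,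
      ← withDensity_apply _ MeasurableSet.univ, ← hmap, Measure.map_apply hε MeasurableSet.univ]
    exact measure_lt_top _ _
  have hE : ∀ b : ℝ, ∫ ω, ρ (ε ω - b) = ∫ t, ρ (t - b) * f t := fun b => by
    rw [← integral_map (f := fun t => ρ (t - b)) hε.aemeasurable
        (hρ.2.2.1.comp (continuous_sub_right b)).aestronglyMeasurable, hmap,
      integral_withDensity_eq_integral_toReal_smul hfm.ennreal_ofReal
        (ae_of_all _ fun _ => ENNReal.ofReal_lt_top)]
    congr 1 with t
    rw [ENNReal.toReal_ofReal (hf0 t), smul_eq_mul, mul_comm]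
  have h0 := hE 0
  simp only [sub_zero] at h0
  rw [h0, hE a]
  exact integral_mul_lt_integral_shift_mul hρ hf heven hanti hδ hstrict ha
end
end

section
/- Under the centered functional quadratic model, assume the error ε has an even density that is non-increasing in |t| and strictly decreasing for |t| in a neighbourhood of 0, and let ρ₁ be a bounded ρ-function. Fix σ > 0 and a triple (a, β, Υ) with β ∈ L²(0,1) and Υ self-adjoint Hilbert–Schmidt, such that (a, β, Υ) ≠ (α₀, β₀, Υ₀). If P( (a − α₀) + ⟨X−μ, β − β₀⟩ + ⟨X−μ, (Υ − Υ₀)(X−μ)⟩ = 0 ) < 1, then L(a, β, Υ, μ, σ) > L(α₀, β₀, Υ₀, μ, σ). -/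
open MeasureTheory Filter
open scoped RealInnerProductSpace ENNReal

noncomputable section

variable {H : Type*} [NormedAddCommGroup H] [InnerProductSpace ℝ H]

/-- Shifting a bounded function that increases with `|t|` increases its integral against
a symmetric unimodal density, strictly when both are strictly monotone near `0`. -/
theorem integral_mul_lt_integral_shift_mul_s5 {g f : ℝ → ℝ} {c δ : ℝ} (hc : c ≠ 0) (hδ : 0 < δ)
    (hgm : Measurable g) (hg0 : ∀ t, 0 ≤ g t) (hg1 : ∀ t, g t ≤ 1)
    (hg : ∀ s t : ℝ, |s| ≤ |t| → g s ≤ g t)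
    (hg' : ∀ s t : ℝ, |s| < δ → |s| < |t| → g s < g t)
    (hfi : Integrable f) (hf : ∀ s t : ℝ, |s| ≤ |t| → f t ≤ f s)
    (hf' : ∀ s t : ℝ, |s| < δ → |s| < |t| → f t < f s) :
    ∫ t, g t * f t < ∫ t, g (t - c) * f t := by
  have hge : ∀ t, g (-t) = g t := fun t => le_antisymm (hg _ _ (by simp)) (hg _ _ (by simp))
  have hfe : ∀ t, f (-t) = f t := fun t => le_antisymm (hf _ _ (by simp)) (hf _ _ (by simp))
  have hmul : ∀ {k φ : ℝ → ℝ}, Measurable k → (∀ t, 0 ≤ k t) → (∀ t, k t ≤ 1) →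
      Integrable φ → Integrable (fun t => k t * φ t) := fun {k φ} hk h0 h1 hφ =>
    hφ.bdd_mul (c := 1) hk.aestronglyMeasurable
      (Eventually.of_forall fun t => by rw [Real.norm_eq_abs, abs_of_nonneg (h0 t)]; exact h1 t)
  have hgcm : Measurable fun t => g (t - c) := hgm.comp (measurable_id.sub_const c)
  have hfci : Integrable fun t => f (t - c) := hfi.comp_sub_right c
  have i1 := hmul hgm hg0 hg1 hfi
  have i2 := hmul hgcm (fun t => hg0 _) (fun t => hg1 _) hfi
  have i3 := hmul hgm hg0 hg1 hfci
  have i4 := hmul hgcm (fun t => hg0 _) (fun t => hg1 _) hfci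
  have e3 : ∫ t, g t * f (t - c) = ∫ t, g (t - c) * f t := by
    rw [← integral_sub_left_eq_self (fun t => g t * f (t - c)) volume c]
    congr 1; ext t
    rw [← hge (c - t), ← hfe (c - t - c)]
    congr 2 <;> ring
  have e4 : ∫ t, g (t - c) * f (t - c) = ∫ t, g t * f t :=
    integral_sub_right_eq_self (fun t => g t * f t) c
  have hsum : ∫ t, (g (t - c) - g t) * (f t - f (t - c))
      = 2 * ((∫ t, g (t - c) * f t) - ∫ t, g t * f t) := by
    have : (fun t => (g (t - c) - g t) * (f t - f (t - c)))
        = fun t => ((g (t - c) * f t - g t * f t)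
          + (g t * f (t - c) - g (t - c) * f (t - c))) := by
      ext t; ring
    rw [this, integral_add (by exact i2.sub i1) (by exact i3.sub i4), integral_sub i2 i1,
      integral_sub i3 i4, e3, e4]
    ring
  have hint : Integrable fun t => (g (t - c) - g t) * (f t - f (t - c)) := by
    have := (i2.sub i1).add (i3.sub i4)
    refine this.congr (Eventually.of_forall fun t => ?_)
    simp only [Pi.add_apply, Pi.sub_apply]; ring
  have hnn : 0 ≤ fun t => (g (t - c) - g t) * (f t - f (t - c)) := by
    intro t
    rcases le_total |t| |t - c| with h | h
    · exact mul_nonneg (sub_nonneg.2 (hg _ _ h)) (sub_nonneg.2 (hf _ _ h))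
    · exact mul_nonneg_of_nonpos_of_nonpos (sub_nonpos.2 (hg _ _ h)) (sub_nonpos.2 (hf _ _ h))
  have hpos : 0 < ∫ t, (g (t - c) - g t) * (f t - f (t - c)) := by
    rw [integral_pos_iff_support_of_nonneg hnn hint]
    refine (Metric.measure_ball_pos volume (0 : ℝ)
      (lt_min hδ (half_pos (abs_pos.2 hc)))).trans_le (measure_mono fun t ht => ?_)
    rw [mem_ball_zero_iff, Real.norm_eq_abs, lt_min_iff] at ht
    have hlt : |t| < |t - c| := by
      have := abs_sub_abs_le_abs_sub c t
      rw [abs_sub_comm] at this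
      linarith [ht.2]
    exact (mul_pos (sub_pos.2 (hg' _ _ ht.1 hlt)) (sub_pos.2 (hf' _ _ ht.1 hlt))).ne'
  linarith

theorem IsBoundedRho.apply_abs_s5 {ρ : ℝ → ℝ} (hρ : IsBoundedRho ρ) (t : ℝ) : ρ |t| = ρ t := by
  rcases abs_choice t with h | h <;> rw [h]
  exact hρ.2.2.2.1 t

theorem IsBoundedRho.le_of_abs_le {ρ : ℝ → ℝ} (hρ : IsBoundedRho ρ) {s t : ℝ}
    (h : |s| ≤ |t|) : ρ s ≤ ρ t := by
  rw [← hρ.apply_abs_s5 s, ← hρ.apply_abs_s5 t]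
  exact hρ.2.2.2.2.1 (abs_nonneg s) (abs_nonneg t) h

theorem IsBoundedRho.lt_of_abs_lt {ρ : ℝ → ℝ} (hρ : IsBoundedRho ρ) {s t : ℝ}
    (hs : ρ s < 1) (h : |s| < |t|) : ρ s < ρ t := by
  rcases lt_or_ge (ρ t) 1 with h1 | h1
  · rw [← hρ.apply_abs_s5 t] at h1
    rw [← hρ.apply_abs_s5 s, ← hρ.apply_abs_s5 t]
    exact hρ.2.2.2.2.2.2.2 _ _ (abs_nonneg s) h h1
  · exact hs.trans_le h1

theorem IsBoundedRho.integrable_comp {α : Type*} [MeasurableSpace α] {ν : Measure α}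
    [IsFiniteMeasure ν] {ρ : ℝ → ℝ} (hρ : IsBoundedRho ρ) {u : α → ℝ} (hu : Measurable u) :
    Integrable (fun x => ρ (u x)) ν :=
  Integrable.of_bound (hρ.2.2.1.measurable.comp hu).aestronglyMeasurable 1
    (Eventually.of_forall fun x => by
      rw [Real.norm_eq_abs, abs_of_nonneg (hρ.1 _)]; exact hρ.2.1 _)

/-- The expected loss of a symmetric unimodal error is strictly increased by any shift. -/
theorem IsBoundedRho.integral_lt_integral_shift {Ω : Type*} [MeasureSpace Ω]
    [IsProbabilityMeasure (volume : Measure Ω)] {ε : Ω → ℝ} (hε : Measurable ε)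
    (hdens : HasSymmUnimodalDensity ε) {ρ : ℝ → ℝ} (hρ : IsBoundedRho ρ) {σ σ₀ x : ℝ}
    (hσ : 0 < σ) (hσ₀ : 0 < σ₀) (hx : x ≠ 0) :
    ∫ t, ρ ((σ₀ * t - 0) / σ) ∂(Measure.map ε volume)
      < ∫ t, ρ ((σ₀ * t - x) / σ) ∂(Measure.map ε volume) := by
  obtain ⟨f, hf0, hmap, hfe, hf, δ, hδ, hfs⟩ := hdens
  have hfabs : ∀ t, f |t| = f t := fun t => by
    rcases abs_choice t with h | h <;> rw [h]
    exact hfe t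
  have hfm : Measurable f := by
    have hanti : Antitone fun t => f (max t 0) := fun s t hst => hf _ _ (by
      rw [abs_of_nonneg (le_max_right _ _), abs_of_nonneg (le_max_right _ _)]
      exact max_le_max_right 0 hst)
    have : f = (fun t => f (max t 0)) ∘ fun t => |t| := by
      ext t; simp [hfabs]
    rw [this]
    exact hanti.measurable.comp measurable_id.abs
  have hprob : IsProbabilityMeasure (Measure.map ε (volume : Measure Ω)) :=
    Measure.isProbabilityMeasure_map hε.aemeasurable
  have hfi : Integrable f := by
    refine ⟨hfm.aestronglyMeasurable, ?_⟩
    rw [hasFiniteIntegral_iff_ofReal (Eventually.of_forall hf0)]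
    have h := hprob.measure_univ
    rw [hmap, withDensity_apply _ MeasurableSet.univ, Measure.restrict_univ] at h
    rw [h]; exact ENNReal.one_lt_top
  have hdensint : ∀ u : ℝ → ℝ, ∫ t, u t ∂(Measure.map ε volume) = ∫ t, u t * f t := by
    intro u
    rw [hmap, integral_withDensity_eq_integral_toReal_smul hfm.ennreal_ofReal
      (Eventually.of_forall fun _ => ENNReal.ofReal_lt_top)]
    refine integral_congr_ae (Eventually.of_forall fun t => ?_)
    simp [ENNReal.toReal_ofReal (hf0 t), mul_comm]
  obtain ⟨η, hη, hηρ⟩ : ∃ η > 0, ∀ t, |t| < η → ρ (σ₀ * t / σ) < 1 := by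
    have hρc : Continuous ρ := hρ.2.2.1
    have hcont : ContinuousAt (fun t => ρ (σ₀ * t / σ)) 0 := by fun_prop
    have hev : ∀ᶠ t in nhds (0 : ℝ), ρ (σ₀ * t / σ) < 1 :=
      Tendsto.eventually_lt_const (by simp [hρ.2.2.2.2.2.1]) hcont
    obtain ⟨η, hη, h⟩ := Metric.eventually_nhds_iff.1 hev
    exact ⟨η, hη, fun t ht => h (by simpa using ht)⟩
  have hscale : ∀ t : ℝ, |σ₀ * t / σ| = σ₀ / σ * |t| := fun t => by
    rw [abs_div, abs_mul, abs_of_pos hσ, abs_of_pos hσ₀]; ring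
  have hpos : 0 < σ₀ / σ := div_pos hσ₀ hσ
  rw [hdensint, hdensint]
  have key := integral_mul_lt_integral_shift_mul_s5 (g := fun t => ρ (σ₀ * t / σ)) (f := f)
    (c := x / σ₀) (δ := min δ η) (div_ne_zero hx hσ₀.ne') (lt_min hδ hη)
    (hρ.2.2.1.measurable.comp (by fun_prop)) (fun t => hρ.1 _) (fun t => hρ.2.1 _)
    (fun s t h => hρ.le_of_abs_le (by
      rw [hscale, hscale]; exact mul_le_mul_of_nonneg_left h hpos.le))
    (fun s t hs h => hρ.lt_of_abs_lt (hηρ s (hs.trans_le (min_le_right _ _))) (by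
      rw [hscale, hscale]; exact mul_lt_mul_of_pos_left h hpos))
    hfi hf
    (fun s t hs h => by
      have hs' := hs.trans_le (min_le_left _ _)
      rw [← hfabs s, ← hfabs t]
      rcases le_total |t| δ with ht | ht
      · exact hfs _ _ (abs_nonneg s) h ht
      · refine (hf δ |t| ?_).trans_lt (hfs _ _ (abs_nonneg s) hs' le_rfl)
        rwa [abs_of_pos hδ, abs_abs])
  have hshift : ∀ t, σ₀ * (t - x / σ₀) = σ₀ * t - x := fun t => by field_simp
  simpa only [hshift, sub_zero] using key

/-- under the centered functional quadratic model, if the candidate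
`(a, β, Υ)` differs from the true parameters and
`P((a−α₀) + ⟨X−μ, β−β₀⟩ + ⟨X−μ, (Υ−Υ₀)(X−μ)⟩ = 0) < 1`, then the risk at `(a, β, Υ)` is
strictly larger than at `(α₀, β₀, Υ₀)`. -/
theorem statement5
    {Ω H : Type*} [MeasureSpace Ω] [IsProbabilityMeasure (volume : Measure Ω)]
    [NormedAddCommGroup H] [InnerProductSpace ℝ H] [CompleteSpace H]
    [MeasurableSpace H] [BorelSpace H]
    (X : Ω → H) (ε y : Ω → ℝ) (hX : Measurable X) (hε : Measurable ε)
    (μ : H) (α₀ : ℝ) (β₀ : H) (Υ₀ : H →L[ℝ] H) (σ₀ : ℝ) (hσ₀ : 0 < σ₀)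
    (hsa₀ : ∀ u v : H, ⟪Υ₀ u, v⟫ = ⟪u, Υ₀ v⟫) (hHS₀ : IsHilbertSchmidt Υ₀)
    (hmodel : ∀ ω, y ω = α₀ + ⟪β₀, X ω - μ⟫ + ⟪X ω - μ, Υ₀ (X ω - μ)⟫ + σ₀ * ε ω)
    (hindep : ProbabilityTheory.IndepFun ε X (volume : Measure Ω))
    (hdens : HasSymmUnimodalDensity ε)
    (ρ₁ : ℝ → ℝ) (hρ₁ : IsBoundedRho ρ₁)
    (σ : ℝ) (hσ : 0 < σ)
    (a : ℝ) (β : H) (Υ : H →L[ℝ] H)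
    (hsa : ∀ u v : H, ⟪Υ u, v⟫ = ⟪u, Υ v⟫) (hHS : IsHilbertSchmidt Υ)
    (hne : ¬(a = α₀ ∧ β = β₀ ∧ Υ = Υ₀))
    (hprob : volume {ω | (a - α₀) + ⟪X ω - μ, β - β₀⟫
        + ⟪X ω - μ, (Υ - Υ₀) (X ω - μ)⟫ = 0} < 1) :
    risk ρ₁ y X α₀ β₀ Υ₀ μ σ < risk ρ₁ y X a β Υ μ σ := by
  have hρc : Continuous ρ₁ := hρ₁.2.2.1
  set D : H → ℝ := fun z => (a - α₀) + ⟪z - μ, β - β₀⟫ + ⟪z - μ, (Υ - Υ₀) (z - μ)⟫ with hD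
  have hDm : Measurable D := by
    refine Continuous.measurable ?_
    fun_prop
  have hDX : Measurable fun ω => D (X ω) := hDm.comp hX
  set ν := Measure.map (fun ω => D (X ω)) (volume : Measure Ω)
  set lam := Measure.map ε (volume : Measure Ω)
  have hν : IsProbabilityMeasure ν := Measure.isProbabilityMeasure_map hDX.aemeasurable
  have hlam : IsProbabilityMeasure lam := Measure.isProbabilityMeasure_map hε.aemeasurable
  have hjoint : Measure.map (fun ω => (D (X ω), ε ω)) (volume : Measure Ω) = ν.prod lam :=
    (ProbabilityTheory.indepFun_iff_map_prod_eq_prod_map_map hDX.aemeasurable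
      hε.aemeasurable).1 (hindep.symm.comp hDm measurable_id)
  set F : ℝ → ℝ := fun x => ∫ t, ρ₁ ((σ₀ * t - x) / σ) ∂lam with hF
  have hui : Integrable (fun p : ℝ × ℝ => ρ₁ ((σ₀ * p.2 - p.1) / σ)) (ν.prod lam) :=
    hρ₁.integrable_comp (by fun_prop)
  have hFi : Integrable F ν := hui.integral_prod_left
  have hrisk : risk ρ₁ y X a β Υ μ σ = ∫ x, F x ∂ν := by
    rw [hF, ← integral_prod _ hui, ← hjoint, integral_map (hDX.prodMk hε).aemeasurable
      (Continuous.aestronglyMeasurable (by fun_prop))]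
    refine integral_congr_ae (Eventually.of_forall fun ω => ?_)
    simp only [hmodel, hD, inner_sub_right, sub_apply,
      real_inner_comm β₀ (X ω - μ)]
    congr 2
    ring
  have hrisk₀ : risk ρ₁ y X α₀ β₀ Υ₀ μ σ = F 0 := by
    simp only [hF, lam]
    rw [integral_map hε.aemeasurable (Continuous.aestronglyMeasurable (by fun_prop))]
    refine integral_congr_ae (Eventually.of_forall fun ω => ?_)
    simp only [hmodel, real_inner_comm β₀ (X ω - μ)]
    congr 2
    ring
  have hlt : ∀ x, x ≠ 0 → F 0 < F x := fun x hx =>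
    hρ₁.integral_lt_integral_shift hε hdens hσ hσ₀ hx
  have hpos : 0 < ∫ x, (F x - F 0) ∂ν := by
    rw [integral_pos_iff_support_of_nonneg _ (by exact hFi.sub (integrable_const _))]
    · have hsupp : ({0}ᶜ : Set ℝ) ⊆ Function.support fun x => F x - F 0 :=
        fun x hx => (sub_pos.2 (hlt x hx)).ne'
      refine lt_of_lt_of_le ?_ (measure_mono hsupp)
      rw [prob_compl_eq_one_sub (measurableSet_singleton 0), tsub_pos_iff_lt,
        Measure.map_apply hDX (measurableSet_singleton 0)]
      exact hprob
    · intro x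
      rcases eq_or_ne x 0 with rfl | hx
      · simp
      · exact (sub_pos.2 (hlt x hx)).le
  rw [integral_sub hFi (integrable_const _)] at hpos
  simp only [integral_const, probReal_univ, one_smul] at hpos
  rw [hrisk, hrisk₀]
  linarith
end
end
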